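/- Let α, β be real numbers with |α| < 1 and |β| < 1, and let E₀ ∈ ℝ. Let T : ℓ²(ℕ, ℝ) → ℓ²(ℕ, ℝ) be the bounded operator (T f)(i) = Σ_{j ∈ ℕ} α^{|i−j|} f(j), and let E ∈ ℓ²(ℕ, ℝ) be the sequence E(n) = E₀ β^n. Then T is invertible and ⟨E, T⁻¹ E⟩ = E₀² (1 − αβ)² / ((1 − α²)(1 − β²)). Consequently, for γ > 0, the maximum over Y ∈ ℓ²(ℕ, ℝ) of U(Y) = ⟨E, Y⟩ − γ⟨Y, T Y⟩ equals (E₀²/(4γ)) · (1 − αβ)² / ((1 − α²)(1 − β²)). -/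

import Mathlib

open scoped RealInnerProductSpace

open ContinuousLinearMap in
/-- The maximum of a concave quadratic utility whose covariance operator `T` is, up to the scalar
`a`, the inverse of `M† M`. -/
theorem isGreatest_quadratic_utility {H : Type*} [NormedAddCommGroup H] [InnerProductSpace ℝ H]
    [CompleteSpace H] {M T : H →L[ℝ] H} {a γ : ℝ} (ha : 0 < a) (hγ : 0 < γ)
    (hMT : (adjoint M * M) * T = a • 1) (hTM : T * (adjoint M * M) = a • 1) (x : H) :
    IsGreatest (Set.range fun y : H => ⟪x, y⟫ - γ * ⟪y, T y⟫)
      (‖M x‖ ^ 2 / (4 * γ * a)) := by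
  have hval (z : H) : ⟪x, adjoint M (M z)⟫ - γ * ⟪adjoint M (M z), T (adjoint M (M z))⟫
      = ⟪M x, M z⟫ - γ * a * ‖M z‖ ^ 2 := by
    have h : T (adjoint M (M z)) = a • z := congr($hTM z)
    rw [h, adjoint_inner_right, adjoint_inner_left, map_smul, inner_smul_right,
      real_inner_self_eq_norm_sq]
    ring
  have hγa : 0 < γ * a := mul_pos hγ ha
  constructor
  · refine ⟨adjoint M (M ((2 * γ * a)⁻¹ • x)), ?_⟩
    simp only [hval]
    rw [map_smul, inner_smul_right, norm_smul, real_inner_self_eq_norm_sq, mul_pow,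
      Real.norm_eq_abs, sq_abs]
    field_simp
    ring
  · rintro _ ⟨y, rfl⟩
    have hy : adjoint M (M (a⁻¹ • T y)) = y := by
      have h : adjoint M (M (T y)) = a • y := congr($hMT y)
      rw [map_smul, map_smul, h, inv_smul_smul₀ ha.ne']
    have hv := hval (a⁻¹ • T y)
    rw [hy] at hv
    simp only [hv]
    have hcs := real_inner_le_norm (M x) (M (a⁻¹ • T y))
    rw [le_div_iff₀ (by positivity)]
    nlinarith [sq_nonneg (‖M x‖ - 2 * (γ * a) * ‖M (a⁻¹ • T y)‖)]

theorem lp.norm_sq_eq_tsum {ι : Type*} (f : lp (fun _ : ι => ℝ) 2) :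
    ‖f‖ ^ 2 = ∑' i, f i ^ 2 := by
  rw [← real_inner_self_eq_norm_sq, lp.inner_eq_tsum]
  simp [pow_two]

theorem lp.summable_sq {ι : Type*} (f : lp (fun _ : ι => ℝ) 2) : Summable fun i => f i ^ 2 := by
  simpa [pow_two] using lp.summable_inner (𝕜 := ℝ) f f

/-- The left shift on `ℓ²(ℕ, ℝ)`. -/
noncomputable def leftShift : lp (fun _ : ℕ => ℝ) 2 →L[ℝ] lp (fun _ : ℕ => ℝ) 2 :=
  LinearMap.mkContinuous
    { toFun f := ⟨fun n => f (n + 1), (memℓp_gen_iff (by norm_num)).2 <| by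
        simpa using (summable_nat_add_iff 1).2 (lp.summable_sq f)⟩
      map_add' _ _ := rfl
      map_smul' _ _ := rfl } 1 fun f => by
    rw [one_mul]
    refine (sq_le_sq₀ (norm_nonneg _) (norm_nonneg _)).1 ?_
    rw [lp.norm_sq_eq_tsum, lp.norm_sq_eq_tsum, (lp.summable_sq f).tsum_eq_zero_add]
    exact le_add_of_nonneg_left (sq_nonneg _)

@[simp]
theorem leftShift_apply (f : lp (fun _ : ℕ => ℝ) 2) (n : ℕ) : leftShift f n = f (n + 1) := rfl

theorem norm_leftShift_le : ‖leftShift‖ ≤ 1 :=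
  LinearMap.mkContinuous_norm_le _ zero_le_one _

theorem adjoint_apply_eq_inner_single (A : lp (fun _ : ℕ => ℝ) 2 →L[ℝ] lp (fun _ : ℕ => ℝ) 2)
    (f : lp (fun _ : ℕ => ℝ) 2) (n : ℕ) :
    ContinuousLinearMap.adjoint A f n = ⟪A (lp.single 2 n 1), f⟫ := by
  rw [← ContinuousLinearMap.adjoint_inner_right, lp.inner_single_left]
  simp

@[simp]
theorem adjoint_leftShift_apply_zero (f : lp (fun _ : ℕ => ℝ) 2) :
    ContinuousLinearMap.adjoint leftShift f 0 = 0 := by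
  have h : leftShift (lp.single 2 0 1) = 0 := by
    ext n
    simp
  rw [adjoint_apply_eq_inner_single, h, inner_zero_left]

@[simp]
theorem adjoint_leftShift_apply_succ (f : lp (fun _ : ℕ => ℝ) 2) (n : ℕ) :
    ContinuousLinearMap.adjoint leftShift f (n + 1) = f n := by
  have h : leftShift (lp.single 2 (n + 1) 1) = lp.single 2 n 1 := by
    ext m
    simp [Pi.single_apply]
  rw [adjoint_apply_eq_inner_single, h, lp.inner_single_left]
  simp

/-- The operator `1 - α L`, with `L` the left shift. -/
noncomputable def oneSubShift (α : ℝ) : lp (fun _ : ℕ => ℝ) 2 →L[ℝ] lp (fun _ : ℕ => ℝ) 2 :=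
  1 - α • leftShift

theorem oneSubShift_apply (α : ℝ) (f : lp (fun _ : ℕ => ℝ) 2) (n : ℕ) :
    oneSubShift α f n = f n - α * f (n + 1) := rfl

theorem adjoint_oneSubShift_apply (α : ℝ) (f : lp (fun _ : ℕ => ℝ) 2) (n : ℕ) :
    ContinuousLinearMap.adjoint (oneSubShift α) f n
      = f n - α * ContinuousLinearMap.adjoint leftShift f n := by
  have h : ContinuousLinearMap.adjoint (oneSubShift α)
      = 1 - α • ContinuousLinearMap.adjoint leftShift := by
    rw [oneSubShift, ← ContinuousLinearMap.star_eq_adjoint, ← ContinuousLinearMap.star_eq_adjoint,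
      star_sub, star_one, star_smul, star_trivial]
  rw [h]
  rfl

theorem isUnit_oneSubShift {α : ℝ} (hα : |α| < 1) : IsUnit (oneSubShift α) := by
  refine isUnit_one_sub_of_norm_lt_one ?_
  rw [norm_smul, Real.norm_eq_abs]
  exact (mul_le_of_le_one_right (abs_nonneg α) norm_leftShift_le).trans_lt hα

theorem summable_toeplitz {α : ℝ} (hα : |α| < 1) (f : lp (fun _ : ℕ => ℝ) 2) (i : ℕ) :
    Summable fun j : ℕ => α ^ ((i : ℤ) - (j : ℤ)).natAbs * f j := by
  have hs : Summable fun j : ℕ => |α| ^ ((i : ℤ) - (j : ℤ)).natAbs := by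
    refine (summable_nat_add_iff i).1 ?_
    simpa using summable_geometric_of_lt_one (abs_nonneg α) hα
  refine .of_norm_bounded (hs.mul_right ‖f‖) fun j => ?_
  rw [norm_mul, norm_pow, Real.norm_eq_abs]
  gcongr
  exact lp.norm_apply_le_norm (by norm_num) f j

theorem oneSubShift_toeplitz {α : ℝ} (hα : |α| < 1)
    {T : lp (fun _ : ℕ => ℝ) 2 →L[ℝ] lp (fun _ : ℕ => ℝ) 2}
    (hT : ∀ f : lp (fun _ : ℕ => ℝ) 2, ∀ i : ℕ,
      T f i = ∑' j : ℕ, α ^ ((i : ℤ) - (j : ℤ)).natAbs * f j)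
    (f : lp (fun _ : ℕ => ℝ) 2) (i : ℕ) :
    oneSubShift α (T f) i = (1 - α ^ 2) * ∑ j ∈ Finset.range (i + 1), α ^ (i - j) * f j := by
  rw [oneSubShift_apply, hT, hT, ← tsum_mul_left, ← (summable_toeplitz hα f i).tsum_sub
    ((summable_toeplitz hα f (i + 1)).mul_left α), tsum_eq_sum (s := Finset.range (i + 1)),
    Finset.mul_sum]
  · refine Finset.sum_congr rfl fun j hj => ?_
    obtain ⟨k, rfl⟩ := Nat.exists_eq_add_of_le (Nat.lt_succ_iff.1 (Finset.mem_range.1 hj))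
    have h₁ : (((j + k : ℕ) : ℤ) - (j : ℤ)).natAbs = k := by omega
    have h₂ : (((j + k + 1 : ℕ) : ℤ) - (j : ℤ)).natAbs = k + 1 := by omega
    rw [h₁, h₂, Nat.add_sub_cancel_left]
    ring
  · intro j hj
    obtain ⟨k, rfl⟩ := Nat.exists_eq_add_of_le (not_lt.1 (mt Finset.mem_range.2 hj))
    have h₁ : ((i : ℤ) - ((i + 1 + k : ℕ) : ℤ)).natAbs = k + 1 := by omega
    have h₂ : (((i + 1 : ℕ) : ℤ) - ((i + 1 + k : ℕ) : ℤ)).natAbs = k := by omega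
    rw [h₁, h₂]
    ring

open ContinuousLinearMap in
theorem adjoint_mul_oneSubShift_mul_toeplitz {α : ℝ} (hα : |α| < 1)
    {T : lp (fun _ : ℕ => ℝ) 2 →L[ℝ] lp (fun _ : ℕ => ℝ) 2}
    (hT : ∀ f : lp (fun _ : ℕ => ℝ) 2, ∀ i : ℕ,
      T f i = ∑' j : ℕ, α ^ ((i : ℤ) - (j : ℤ)).natAbs * f j) :
    (adjoint (oneSubShift α) * oneSubShift α) * T = (1 - α ^ 2) • 1 := by
  ext f i
  change adjoint (oneSubShift α) (oneSubShift α (T f)) i = (1 - α ^ 2) * f i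
  rw [adjoint_oneSubShift_apply]
  cases i with
  | zero =>
    rw [adjoint_leftShift_apply_zero, oneSubShift_toeplitz hα hT]
    simp
  | succ i =>
    rw [adjoint_leftShift_apply_succ, oneSubShift_toeplitz hα hT, oneSubShift_toeplitz hα hT,
      Finset.sum_range_succ _ (i + 1)]
    have h : ∑ j ∈ Finset.range (i + 1), α ^ (i + 1 - j) * f j
        = α * ∑ j ∈ Finset.range (i + 1), α ^ (i - j) * f j := by
      rw [Finset.mul_sum]
      refine Finset.sum_congr rfl fun j hj => ?_
      rw [Nat.succ_sub (Nat.lt_succ_iff.1 (Finset.mem_range.1 hj)), pow_succ']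
      ring
    rw [h, Nat.sub_self, pow_zero]
    ring

theorem norm_sq_oneSubShift_geometric (α : ℝ) {β E₀ : ℝ} (hβ : |β| < 1)
    {E : lp (fun _ : ℕ => ℝ) 2} (hE : ∀ n : ℕ, E n = E₀ * β ^ n) :
    ‖oneSubShift α E‖ ^ 2 = E₀ ^ 2 * (1 - α * β) ^ 2 / (1 - β ^ 2) := by
  have h (n : ℕ) : oneSubShift α E n ^ 2 = E₀ ^ 2 * (1 - α * β) ^ 2 * (β ^ 2) ^ n := by
    rw [oneSubShift_apply, hE, hE]
    ring
  rw [lp.norm_sq_eq_tsum]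
  simp_rw [h]
  rw [tsum_mul_left, tsum_geometric_of_lt_one (sq_nonneg β) ((sq_lt_one_iff_abs_lt_one β).2 hβ),
    div_eq_mul_inv]

/-- Let `|α| < 1`, `|β| < 1`, `E₀ ∈ ℝ`.  The Toeplitz operator
`(T f)(i) = Σ_j α^{|i−j|} f(j)` on `ℓ²(ℕ, ℝ)` is invertible, and with `E(n) = E₀ β^n` one
has `⟨E, T⁻¹E⟩ = E₀²(1 − αβ)²/((1 − α²)(1 − β²))`.  Consequently, for `γ > 0` the maximum
over `Y` of `U(Y) = ⟨E, Y⟩ − γ⟨Y, T Y⟩` equals `(E₀²/(4γ))·(1 − αβ)²/((1 − α²)(1 − β²))`. -/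
theorem ar1_utility (α β E₀ : ℝ) (hα : |α| < 1) (hβ : |β| < 1)
    (T : lp (fun _ : ℕ => ℝ) 2 →L[ℝ] lp (fun _ : ℕ => ℝ) 2)
    (hT : ∀ f : lp (fun _ : ℕ => ℝ) 2, ∀ i : ℕ,
      T f i = ∑' j : ℕ, α ^ ((i : ℤ) - (j : ℤ)).natAbs * f j)
    (E : lp (fun _ : ℕ => ℝ) 2) (hE : ∀ n : ℕ, E n = E₀ * β ^ n) :
    (∃ S : lp (fun _ : ℕ => ℝ) 2 →L[ℝ] lp (fun _ : ℕ => ℝ) 2,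
      S.comp T = ContinuousLinearMap.id ℝ _ ∧ T.comp S = ContinuousLinearMap.id ℝ _) ∧
    (∀ S : lp (fun _ : ℕ => ℝ) 2 →L[ℝ] lp (fun _ : ℕ => ℝ) 2,
      S.comp T = ContinuousLinearMap.id ℝ _ → T.comp S = ContinuousLinearMap.id ℝ _ →
      ⟪E, S E⟫ = E₀ ^ 2 * (1 - α * β) ^ 2 / ((1 - α ^ 2) * (1 - β ^ 2))) ∧
    (∀ γ : ℝ, 0 < γ →
      IsGreatest (Set.range fun Y : lp (fun _ : ℕ => ℝ) 2 => ⟪E, Y⟫ - γ * ⟪Y, T Y⟫)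
        ((E₀ ^ 2 / (4 * γ)) * ((1 - α * β) ^ 2 / ((1 - α ^ 2) * (1 - β ^ 2))))) := by
  have ha : 0 < 1 - α ^ 2 := sub_pos.2 ((sq_lt_one_iff_abs_lt_one α).2 hα)
  have hb : 0 < 1 - β ^ 2 := sub_pos.2 ((sq_lt_one_iff_abs_lt_one β).2 hβ)
  set M := oneSubShift α
  set N := ContinuousLinearMap.adjoint M * M
  have hNT : N * T = (1 - α ^ 2) • 1 := adjoint_mul_oneSubShift_mul_toeplitz hα hT
  have hNu : IsUnit N := (isUnit_oneSubShift hα).star.mul (isUnit_oneSubShift hα)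
  have hTN : T * N = (1 - α ^ 2) • 1 := by
    refine hNu.mul_left_cancel ?_
    rw [← mul_assoc, hNT, smul_mul_assoc, one_mul, mul_smul_comm, mul_one]
  have hST : ((1 - α ^ 2)⁻¹ • N) * T = 1 := by
    rw [smul_mul_assoc, hNT, inv_smul_smul₀ ha.ne']
  have hTS : T * ((1 - α ^ 2)⁻¹ • N) = 1 := by
    rw [mul_smul_comm, hTN, inv_smul_smul₀ ha.ne']
  have hM := norm_sq_oneSubShift_geometric α hβ hE
  refine ⟨⟨_, hST, hTS⟩, fun S hS _ => ?_, fun γ hγ => ?_⟩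
  · have hSN : S = (1 - α ^ 2)⁻¹ • N := left_inv_eq_right_inv (a := T) hS hTS
    have h : S E = (1 - α ^ 2)⁻¹ • ContinuousLinearMap.adjoint M (M E) := congr($hSN E)
    rw [h, inner_smul_right, ContinuousLinearMap.adjoint_inner_right, real_inner_self_eq_norm_sq,
      hM]
    field_simp
  · convert isGreatest_quadratic_utility ha hγ hNT hTN E using 1
    rw [hM]
    field_simp
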